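/- Let k be a positive integer and let G be a finite simple graph on n ≥ 2 vertices with minimum degree δ ≥ k and maximum degree Δ. Then F_k(G) ≤ (Δ - k + 1)·n / (Δ + 1). -/

import Mathlib

open Finset SimpleGraph

/-- One round of the `k`-forcing color change rule: to the currently colored set `C` we add
every vertex `w` having a colored neighbor `v` with at most `k` non-colored neighbors. -/
def kForceStep {V : Type*} [Fintype V] [DecidableEq V] (G : SimpleGraph V)
    [DecidableRel G.Adj] (k : ℕ) (C : Finset V) : Finset V :=
  C ∪ Finset.univ.filter (fun w =>
    ∃ v ∈ C, G.Adj v w ∧ ((G.neighborFinset v) \ C).card ≤ k)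

/-- `S` is a `k`-forcing set: iterating the color change rule starting from `S`
eventually colors all vertices. -/
def IsKForcingSet {V : Type*} [Fintype V] [DecidableEq V] (G : SimpleGraph V)
    [DecidableRel G.Adj] (k : ℕ) (S : Finset V) : Prop :=
  (kForceStep G k)^[Fintype.card V] S = Finset.univ

/-- The `k`-forcing number: the minimum cardinality of a `k`-forcing set. -/
noncomputable def kForcingNumber {V : Type*} [Fintype V] [DecidableEq V] (G : SimpleGraph V)
    [DecidableRel G.Adj] (k : ℕ) : ℕ :=
  sInf {m | ∃ S : Finset V, IsKForcingSet G k S ∧ S.card = m}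

section

variable {V : Type*} [Fintype V] [DecidableEq V] {G : SimpleGraph V} [DecidableRel G.Adj] {k : ℕ}

lemma subset_kForceStep (C : Finset V) : C ⊆ kForceStep G k C :=
  Finset.subset_union_left

lemma mem_kForceStep {C : Finset V} {v w : V} (hv : v ∈ C) (hw : G.Adj v w)
    (h : (G.neighborFinset v \ C).card ≤ k) : w ∈ kForceStep G k C :=
  Finset.mem_union_right _ (by simpa using ⟨v, hv, hw, h⟩)

lemma kForceStep_mono : Monotone (kForceStep G k) := by
  intro C D hCD w hw
  rcases Finset.mem_union.1 hw with hw | hw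
  · exact subset_kForceStep D (hCD hw)
  · obtain ⟨v, hv, hvw, h⟩ := (Finset.mem_filter.1 hw).2
    exact mem_kForceStep (hCD hv) hvw
      ((Finset.card_le_card (Finset.sdiff_subset_sdiff subset_rfl hCD)).trans h)

variable (G k) in
/-- The set of vertices eventually colored when starting from `S`. -/
def kForcingClosure (S : Finset V) : Finset V :=
  (kForceStep G k)^[Fintype.card V] S

lemma subset_kForcingClosure (S : Finset V) : S ⊆ kForcingClosure G k S :=
  Function.id_le_iterate_of_id_le (f := kForceStep G k) subset_kForceStep (Fintype.card V) S

lemma kForcingClosure_mono : Monotone (kForcingClosure G k) :=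
  kForceStep_mono.iterate _

lemma kForceStep_iterate_eq_or_le_card (S : Finset V) (m : ℕ) :
    kForceStep G k ((kForceStep G k)^[m] S) = (kForceStep G k)^[m] S ∨
      m ≤ ((kForceStep G k)^[m] S).card := by
  induction m with
  | zero => simp
  | succ m ih =>
    rw [Function.iterate_succ_apply']
    by_cases h : kForceStep G k ((kForceStep G k)^[m] S) = (kForceStep G k)^[m] S
    · exact Or.inl (by rw [h, h])
    · have hlt := Finset.card_lt_card
        ((subset_kForceStep (G := G) (k := k) ((kForceStep G k)^[m] S)).ssubset_of_ne (Ne.symm h))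
      have hle := ih.resolve_left h
      exact Or.inr (by omega)

lemma kForceStep_kForcingClosure (S : Finset V) :
    kForceStep G k (kForcingClosure G k S) = kForcingClosure G k S := by
  rcases kForceStep_iterate_eq_or_le_card (G := G) (k := k) S (Fintype.card V) with h | h
  · exact h
  · have huniv : kForcingClosure G k S = Finset.univ :=
      Finset.eq_univ_of_card _ (le_antisymm (Finset.card_le_univ _) h)
    rw [huniv]
    exact Finset.univ_subset_iff.1 (subset_kForceStep _)

lemma neighborFinset_subset_kForcingClosure {S : Finset V} {v : V}
    (hv : v ∈ kForcingClosure G k S)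
    (h : (G.neighborFinset v \ kForcingClosure G k S).card ≤ k) :
    G.neighborFinset v ⊆ kForcingClosure G k S := by
  intro w hw
  rw [← kForceStep_kForcingClosure]
  exact mem_kForceStep hv ((G.mem_neighborFinset v w).1 hw) h

/-- Adding to `S` all but `k` of the uncolored neighbors of `v`, and `v` itself if necessary,
eventually colors `v` and all its neighbors. -/
lemma exists_insert_neighborFinset_subset_kForcingClosure (S : Finset V) (v : V)
    (hk : k ≤ (G.neighborFinset v \ kForcingClosure G k S).card) :
    ∃ A : Finset V, A.card + k = (G.neighborFinset v \ kForcingClosure G k S).card ∧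
      ∀ T, S ∪ A ⊆ T → v ∈ kForcingClosure G k T →
        G.neighborFinset v ⊆ kForcingClosure G k T := by
  obtain ⟨A, hAU, hA⟩ := Finset.exists_subset_card_eq
    (Nat.sub_le (G.neighborFinset v \ kForcingClosure G k S).card k)
  refine ⟨A, by omega, fun T hT hv => neighborFinset_subset_kForcingClosure hv ?_⟩
  have hsub : G.neighborFinset v \ kForcingClosure G k T ⊆
      (G.neighborFinset v \ kForcingClosure G k S) \ A := by
    intro w hw
    obtain ⟨hwN, hwT⟩ := Finset.mem_sdiff.1 hw
    refine Finset.mem_sdiff.2 ⟨Finset.mem_sdiff.2 ⟨hwN, fun h => hwT ?_⟩, fun h => hwT ?_⟩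
    · exact kForcingClosure_mono (Finset.union_subset_left hT) h
    · exact subset_kForcingClosure T (Finset.union_subset_right hT h)
  have hcard := Finset.card_le_card hsub
  rw [Finset.card_sdiff_of_subset hAU] at hcard
  omega

/-- If `S` is not a `k`-forcing set, then it can be enlarged by `b - k` vertices so that at least
`b` further vertices eventually become colored, for some `0 < b ≤ Δ + 1`. -/
lemma exists_kForcingClosure_card_add_le (hδ : k ≤ G.minDegree) {S : Finset V}
    (hS : kForcingClosure G k S ≠ Finset.univ) :
    ∃ (T : Finset V) (b : ℕ), 0 < b ∧ b ≤ G.maxDegree + 1 ∧ T.card + k ≤ S.card + b ∧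
      (kForcingClosure G k S).card + b ≤ (kForcingClosure G k T).card := by
  by_cases hex : ∃ v ∈ kForcingClosure G k S,
      (G.neighborFinset v \ kForcingClosure G k S).Nonempty
  · obtain ⟨v, hv, w, hw⟩ := hex
    obtain ⟨hwN, hwC⟩ := Finset.mem_sdiff.1 hw
    have hlt : k < (G.neighborFinset v \ kForcingClosure G k S).card := by
      by_contra! hle
      exact hwC (neighborFinset_subset_kForcingClosure hv hle hwN)
    obtain ⟨A, hA, hT⟩ := exists_insert_neighborFinset_subset_kForcingClosure S v hlt.le
    have hmono := kForcingClosure_mono (G := G) (k := k)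
      (Finset.subset_union_left (s₁ := S) (s₂ := A))
    refine ⟨S ∪ A, _, (Nat.zero_le k).trans_lt hlt, ?_, ?_, ?_⟩
    · have h₁ := Finset.card_le_card
        (Finset.sdiff_subset (s := G.neighborFinset v) (t := kForcingClosure G k S))
      have h₂ := G.degree_le_maxDegree v
      rw [G.card_neighborFinset_eq_degree] at h₁
      omega
    · have := Finset.card_union_le S A
      omega
    · rw [← Finset.card_union_of_disjoint Finset.disjoint_sdiff]
      exact Finset.card_le_card (Finset.union_subset hmono
        (Finset.sdiff_subset.trans (hT _ subset_rfl (hmono hv))))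
  · push Not at hex
    obtain ⟨v, hv⟩ : ∃ v, v ∉ kForcingClosure G k S := by
      simpa [Finset.eq_univ_iff_forall] using hS
    have hdisj : Disjoint (G.neighborFinset v) (kForcingClosure G k S) := by
      refine Finset.disjoint_left.2 fun w hw hwC => ?_
      have : v ∈ G.neighborFinset w \ kForcingClosure G k S :=
        Finset.mem_sdiff.2
          ⟨(G.mem_neighborFinset w v).2 ((G.mem_neighborFinset v w).1 hw).symm, hv⟩
      simp [hex w hwC] at this
    have hcard : (G.neighborFinset v \ kForcingClosure G k S).card = G.degree v := by
      rw [Finset.sdiff_eq_self_of_disjoint hdisj, G.card_neighborFinset_eq_degree]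
    obtain ⟨A, hA, hT⟩ := exists_insert_neighborFinset_subset_kForcingClosure S v
      (hcard ▸ hδ.trans (G.minDegree_le_degree v))
    have hsub : S ∪ A ⊆ insert v (S ∪ A) := Finset.subset_insert _ _
    have hvT := subset_kForcingClosure (G := G) (k := k) _ (Finset.mem_insert_self v (S ∪ A))
    refine ⟨insert v (S ∪ A), G.degree v + 1, Nat.succ_pos _,
      Nat.succ_le_succ (G.degree_le_maxDegree v), ?_, ?_⟩
    · have h₁ := Finset.card_insert_le v (S ∪ A)
      have h₂ := Finset.card_union_le S A
      omega
    · have hB : (insert v (G.neighborFinset v)).card = G.degree v + 1 := by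
        rw [Finset.card_insert_of_notMem (by simp), G.card_neighborFinset_eq_degree]
      rw [← hB, ← Finset.card_union_of_disjoint
        (Finset.disjoint_insert_right.2 ⟨hv, hdisj.symm⟩)]
      exact Finset.card_le_card (Finset.union_subset
        (kForcingClosure_mono (Finset.union_subset_left hsub))
        (Finset.insert_subset hvT (hT _ hsub hvT)))

lemma kForcingNumber_le_card {S : Finset V} (hS : IsKForcingSet G k S) :
    kForcingNumber G k ≤ S.card :=
  Nat.sInf_le ⟨S, hS, rfl⟩

lemma exists_isKForcingSet_card_mul_le (hδ : k ≤ G.minDegree) :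
    ∃ S : Finset V, IsKForcingSet G k S ∧
      (S.card : ℝ) * (G.maxDegree + 1) ≤ (G.maxDegree - k + 1) * Fintype.card V := by
  classical
  obtain ⟨S, hS, hmax⟩ := Finset.exists_max_image
    (Finset.univ.filter fun S : Finset V =>
      (S.card : ℝ) * (G.maxDegree + 1) ≤ (G.maxDegree - k + 1) * (kForcingClosure G k S).card)
    (fun S => (kForcingClosure G k S).card)
    ⟨∅, by
      have hkΔ : (k : ℝ) ≤ G.maxDegree := by exact_mod_cast hδ.trans G.minDegree_le_maxDegree
      simpa using mul_nonneg (by linarith : (0 : ℝ) ≤ G.maxDegree - k + 1) (Nat.cast_nonneg _)⟩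
  have hS := (Finset.mem_filter.1 hS).2
  have huniv : kForcingClosure G k S = Finset.univ := by
    by_contra hne
    obtain ⟨T, b, hb, hbΔ, hT, hcl⟩ := exists_kForcingClosure_card_add_le hδ hne
    have hkΔ : (k : ℝ) ≤ G.maxDegree := by exact_mod_cast hδ.trans G.minDegree_le_maxDegree
    have hbΔ' : (b : ℝ) ≤ G.maxDegree + 1 := by exact_mod_cast hbΔ
    have hT' : (T.card : ℝ) ≤ S.card + b - k := by
      rw [le_sub_iff_add_le]
      exact_mod_cast hT
    have hcl' : ((kForcingClosure G k S).card : ℝ) + b ≤ (kForcingClosure G k T).card := by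
      exact_mod_cast hcl
    have hle := hmax T <| Finset.mem_filter.2 ⟨Finset.mem_univ _, by
      calc (T.card : ℝ) * (G.maxDegree + 1)
          ≤ (S.card + b - k) * (G.maxDegree + 1) := by gcongr
        _ ≤ (G.maxDegree - k + 1) * ((kForcingClosure G k S).card + b) := by
          nlinarith [mul_le_mul_of_nonneg_left hbΔ' (Nat.cast_nonneg (α := ℝ) k)]
        _ ≤ (G.maxDegree - k + 1) * (kForcingClosure G k T).card :=
          mul_le_mul_of_nonneg_left hcl' (by linarith)⟩
    omega
  refine ⟨S, huniv, ?_⟩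
  rwa [huniv, Finset.card_univ] at hS

end

/-- Corollary: If `G` has `n ≥ 2` vertices and minimum degree `δ ≥ k`, then
`F_k(G) ≤ (Δ - k + 1) n / (Δ + 1)`. -/
theorem kForcingNumber_le_of_minDegree_ge {V : Type*} [Fintype V] [DecidableEq V]
    (G : SimpleGraph V) [DecidableRel G.Adj] (k : ℕ) (hk : 1 ≤ k)
    (hn : 2 ≤ Fintype.card V) (hδ : k ≤ G.minDegree) :
    (kForcingNumber G k : ℝ) ≤
      ((G.maxDegree : ℝ) - k + 1) * (Fintype.card V) / ((G.maxDegree : ℝ) + 1) := by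
  obtain ⟨S, hS, hcard⟩ := exists_isKForcingSet_card_mul_le hδ
  rw [le_div_iff₀ (by positivity)]
  refine le_trans ?_ hcard
  gcongr
  exact kForcingNumber_le_card hS
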